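/- Let f(x) = x^5 + a x + b ∈ ℤ[x] be irreducible with 5 | a and 5 ∤ b, and let θ be a root. Then 5 divides the index [O_{ℚ(θ)} : ℤ[θ]] if and only if b ≡ 1 + a, 7 + 2a, 18 + 3a, or 24 + 4a (mod 25). -/

import Mathlib

open Polynomial NumberField

/-- The index of the order `ℤ[θ]` in the ring of integers of `K`. -/
noncomputable def indexZTheta {K : Type*} [Field K] [NumberField K]
    (θ : NumberField.RingOfIntegers K) : ℕ :=
  (Algebra.adjoin ℤ ({θ} : Set (NumberField.RingOfIntegers K))).toSubring.toAddSubgroup.index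

theorem aux_zmod : ∀ a b : ZMod 25, 5 * a = 0 → 5 * b ≠ 0 →
    (b ^ 5 + a * b - b = 0 ↔
      (b = 1 + a ∨ b = 7 + 2 * a ∨ b = 18 + 3 * a ∨ b = 24 + 4 * a)) := by
  decide +kernel

theorem aux_arith (a b : ℤ) (ha : (5 : ℤ) ∣ a) (hb : ¬ (5 : ℤ) ∣ b) :
    ((25 : ℤ) ∣ b ^ 5 + a * b - b) ↔
      (b ≡ 1 + a [ZMOD 25] ∨ b ≡ 7 + 2 * a [ZMOD 25] ∨
        b ≡ 18 + 3 * a [ZMOD 25] ∨ b ≡ 24 + 4 * a [ZMOD 25]) := by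
  have key := aux_zmod (a : ZMod 25) (b : ZMod 25) ?_ ?_
  · have h1 := ZMod.intCast_zmod_eq_zero_iff_dvd (b ^ 5 + a * b - b) 25
    have h2 := fun c : ℤ => ZMod.intCast_eq_intCast_iff b c 25
    have e1 := h2 (1 + a)
    have e2 := h2 (7 + 2 * a)
    have e3 := h2 (18 + 3 * a)
    have e4 := h2 (24 + 4 * a)
    push_cast at h1 e1 e2 e3 e4
    rw [← h1, ← e1, ← e2, ← e3, ← e4]
    exact key
  · have := (ZMod.intCast_zmod_eq_zero_iff_dvd (5 * a) 25).2 (by push_cast; omega)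
    push_cast at this
    exact this
  · intro h
    have := (ZMod.intCast_zmod_eq_zero_iff_dvd (5 * b) 25).1 (by push_cast; exact h)
    push_cast at this
    omega

theorem aux_mem {K : Type*} [Field K] [NumberField K] (θ x : NumberField.RingOfIntegers K) :
    x ∈ Algebra.adjoin ℤ ({θ} : Set (NumberField.RingOfIntegers K)) ↔
      (x : K) ∈ Algebra.adjoin ℤ ({(θ : K)} : Set K) := by
  let φ : NumberField.RingOfIntegers K →ₐ[ℤ] K :=
    IsScalarTower.toAlgHom ℤ (NumberField.RingOfIntegers K) K
  have h := AlgHom.map_adjoin φ ({θ} : Set (NumberField.RingOfIntegers K))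
  rw [Set.image_singleton] at h
  change _ ↔ φ x ∈ Algebra.adjoin ℤ ({φ θ} : Set K)
  rw [← h, Subalgebra.mem_map]
  constructor
  · intro hx
    exact ⟨x, hx, rfl⟩
  · rintro ⟨y, hy, hxy⟩
    have : y = x := NumberField.RingOfIntegers.coe_injective hxy
    exact this ▸ hy

/-- Every element of `ℚ(θ)` has a nonzero integer multiple in `ℤ[θ]`. -/
theorem aux_mult {K : Type*} [Field K] [NumberField K] (t : K)
    (hgen : Algebra.adjoin ℚ ({t} : Set K) = ⊤) (x : K) :
    ∃ n : ℤ, n ≠ 0 ∧ (n : K) * x ∈ Algebra.adjoin ℤ ({t} : Set K) := by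
  have hx : x ∈ Algebra.adjoin ℚ ({t} : Set K) := hgen ▸ Algebra.mem_top
  have hint : ∀ n : ℤ, (n : K) ∈ Algebra.adjoin ℤ ({t} : Set K) := fun n => intCast_mem _ n
  induction hx using Algebra.adjoin_induction with
  | mem x hx => exact ⟨1, one_ne_zero, by simpa using Algebra.subset_adjoin hx⟩
  | algebraMap r =>
    refine ⟨r.den, by exact_mod_cast r.den_ne_zero, ?_⟩
    have : ((r.den : ℤ) : K) * algebraMap ℚ K r = ((r.num : ℤ) : K) := by
      have h := Rat.den_mul_eq_num r
      have h' := congrArg (algebraMap ℚ K) h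
      rw [map_mul, map_natCast, map_intCast] at h'
      exact_mod_cast h'
    rw [this]
    exact hint _
  | add x y _ _ hx hy =>
    obtain ⟨n, hn, hn'⟩ := hx
    obtain ⟨m, hm, hm'⟩ := hy
    refine ⟨n * m, mul_ne_zero hn hm, ?_⟩
    have : ((n * m : ℤ) : K) * (x + y) = m * (n * x) + n * (m * y) := by push_cast; ring
    rw [this]
    exact add_mem (mul_mem (hint m) hn') (mul_mem (hint n) hm')
  | mul x y _ _ hx hy =>
    obtain ⟨n, hn, hn'⟩ := hx
    obtain ⟨m, hm, hm'⟩ := hy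
    refine ⟨n * m, mul_ne_zero hn hm, ?_⟩
    have : ((n * m : ℤ) : K) * (x * y) = (n * x) * (m * y) := by push_cast; ring
    rw [this]
    exact mul_mem hn' hm'

/-- `5` divides the index iff there is an integral `α ∉ ℤ[θ]` with `5 α ∈ ℤ[θ]`. -/
theorem aux_index {K : Type*} [Field K] [NumberField K] (θ : NumberField.RingOfIntegers K)
    (hgen : Algebra.adjoin ℚ ({(θ : K)} : Set K) = ⊤) :
    5 ∣ indexZTheta θ ↔ ∃ α : NumberField.RingOfIntegers K,
      α ∉ Algebra.adjoin ℤ ({θ} : Set (NumberField.RingOfIntegers K)) ∧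
      5 * α ∈ Algebra.adjoin ℤ ({θ} : Set (NumberField.RingOfIntegers K)) := by
  set S := Algebra.adjoin ℤ ({θ} : Set (NumberField.RingOfIntegers K)) with hS
  have hmem : ∀ x, x ∈ S.toSubring.toAddSubgroup ↔ x ∈ S := fun x => Iff.rfl
  set H := S.toSubring.toAddSubgroup with hH
  have : Fact (Nat.Prime 5) := ⟨by norm_num⟩
  change 5 ∣ Nat.card (NumberField.RingOfIntegers K ⧸ H) ↔ _
  constructor
  · intro h
    have hfin : Finite (NumberField.RingOfIntegers K ⧸ H) := by
      have : Module.Finite ℤ (NumberField.RingOfIntegers K ⧸ H) :=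
        Module.Finite.of_surjective (QuotientAddGroup.mk' H).toIntLinearMap
          (QuotientAddGroup.mk'_surjective H)
      apply Module.finite_of_fg_torsion
      intro x
      obtain ⟨x, rfl⟩ := QuotientAddGroup.mk'_surjective H x
      obtain ⟨n, hn, hn'⟩ := aux_mult (θ : K) hgen (x : K)
      refine ⟨⟨n, mem_nonZeroDivisors_of_ne_zero hn⟩, ?_⟩
      change n • (QuotientAddGroup.mk' H x) = 0
      rw [← map_zsmul, QuotientAddGroup.mk'_apply, QuotientAddGroup.eq_zero_iff, hmem,
        aux_mem]
      simpa using hn'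
    obtain ⟨x, hx⟩ := exists_prime_addOrderOf_dvd_card' 5 h
    obtain ⟨x, rfl⟩ := QuotientAddGroup.mk'_surjective H x
    refine ⟨x, ?_, ?_⟩
    · intro hxS
      have : QuotientAddGroup.mk' H x = 0 := by
        rw [QuotientAddGroup.mk'_apply, QuotientAddGroup.eq_zero_iff]
        exact hxS
      rw [this] at hx
      simp at hx
    · have h5 := addOrderOf_nsmul_eq_zero (QuotientAddGroup.mk' H x)
      rw [hx, ← map_nsmul, QuotientAddGroup.mk'_apply, QuotientAddGroup.eq_zero_iff, hmem] at h5
      simpa using h5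
  · rintro ⟨α, h1, h2⟩
    have : addOrderOf (QuotientAddGroup.mk' H α) = 5 := by
      apply addOrderOf_eq_prime
      · rw [← map_nsmul, QuotientAddGroup.mk'_apply, QuotientAddGroup.eq_zero_iff, hmem]
        simpa using h2
      · rw [QuotientAddGroup.mk'_apply, Ne, QuotientAddGroup.eq_zero_iff]
        exact h1
    rw [← this]
    exact addOrderOf_dvd_natCard _

theorem aux_eis (a b : ℤ) (ha : (5 : ℤ) ∣ a) (h25 : ¬ (25 : ℤ) ∣ b ^ 5 + a * b - b)
    (g : ℤ[X])
    (hg : g = X ^ 5 + C (-5 * b) * X ^ 4 + C (10 * b ^ 2) * X ^ 3 + C (-10 * b ^ 3) * X ^ 2 +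
      C (5 * b ^ 4 + a) * X + C (-(b ^ 5 + a * b - b))) :
    g.Monic ∧ g.natDegree = 5 ∧ g.IsEisensteinAt (Ideal.span {(5 : ℤ)}) := by
  have hd : g.natDegree = 5 := by rw [hg]; compute_degree!
  have hm : g.Monic := by rw [hg]; monicity!
  have h5 : Prime (5 : ℤ) := by norm_num
  refine ⟨hm, hd, ?_⟩
  refine hm.isEisensteinAt_of_mem_of_notMem
    (Ideal.IsPrime.ne_top <| (Ideal.span_singleton_prime (by norm_num)).2 h5) ?_ ?_
  · intro i hi
    rw [hd] at hi
    rw [Ideal.mem_span_singleton, hg]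
    have hfl : (5 : ℤ) ∣ b ^ 5 - b := by
      have h : ∀ x : ZMod 5, x ^ 5 - x = 0 := by decide
      have := (ZMod.intCast_zmod_eq_zero_iff_dvd (b ^ 5 - b) 5).1 (by push_cast; exact h _)
      exact_mod_cast this
    obtain ⟨a', rfl⟩ := ha
    obtain ⟨k, hk⟩ := hfl
    interval_cases i
    · simp only [coeff_add, coeff_C_mul, coeff_X_pow, coeff_X, coeff_C]
      norm_num
      exact ⟨-k - a' * b, by linarith⟩
    · simp only [coeff_add, coeff_C_mul, coeff_X_pow, coeff_X, coeff_C]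
      norm_num
    · simp only [coeff_add, coeff_C_mul, coeff_X_pow, coeff_X, coeff_C]
      norm_num
      exact ⟨2 * b ^ 3, by ring⟩
    · simp only [coeff_add, coeff_C_mul, coeff_X_pow, coeff_X, coeff_C]
      norm_num
      exact ⟨2 * b ^ 2, by ring⟩
    · simp only [coeff_add, coeff_C_mul, coeff_X_pow, coeff_X, coeff_C]
      norm_num
  · rw [Ideal.span_singleton_pow, Ideal.mem_span_singleton, hg]
    intro h
    apply h25
    rw [← dvd_neg]
    simp only [coeff_add, coeff_C_mul, coeff_X_pow, coeff_X, coeff_C] at h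
    norm_num at h ⊢
    exact h

theorem stmt7 (a b : ℤ) (ha : (5 : ℤ) ∣ a) (hb : ¬ (5 : ℤ) ∣ b)
    (f : ℤ[X]) (hf : f = X ^ 5 + C a * X + C b)
    (hirr : Irreducible (f.map (Int.castRingHom ℚ)))
    (K : Type*) [Field K] [NumberField K] (θ : NumberField.RingOfIntegers K)
    (hroot : Polynomial.aeval θ f = 0)
    (hgen : Algebra.adjoin ℚ ({(θ : K)} : Set K) = ⊤) :
    5 ∣ indexZTheta θ ↔
      (b ≡ 1 + a [ZMOD 25] ∨ b ≡ 7 + 2 * a [ZMOD 25] ∨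
        b ≡ 18 + 3 * a [ZMOD 25] ∨ b ≡ 24 + 4 * a [ZMOD 25]) := by
  rw [← aux_arith a b ha hb, aux_index θ hgen]
  have hr : θ ^ 5 + a * θ + b = 0 := by
    have := hroot
    rw [hf] at this
    simpa using this
  have hrK : (θ : K) ^ 5 + a * (θ : K) + b = 0 := by
    have := congrArg (algebraMap (NumberField.RingOfIntegers K) K) hr
    simpa using this
  set t : K := (θ : K) with ht
  constructor
  · rintro ⟨α, hα, h5α⟩
    by_contra h25
    obtain ⟨hm, hd, hE⟩ := aux_eis a b ha h25 _ rfl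
    set g : ℤ[X] := X ^ 5 + C (-5 * b) * X ^ 4 + C (10 * b ^ 2) * X ^ 3 + C (-10 * b ^ 3) * X ^ 2 +
      C (5 * b ^ 4 + a) * X + C (-(b ^ 5 + a * b - b)) with hg
    have h5 : Prime (5 : ℤ) := by norm_num
    have hgi : Irreducible g := hE.irreducible
      ((Ideal.span_singleton_prime (by norm_num)).2 h5) hm.isPrimitive (by omega)
    set y : K := t + b with hy
    have hgy : aeval y g = 0 := by
      have : aeval y g = t ^ 5 + a * t + b := by
        rw [hg, hy]
        rw [aeval_def]
        simp only [eval₂_add, eval₂_mul, eval₂_pow, eval₂_X, eval₂_C]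
        simp only [algebraMap_int_eq, eq_intCast]
        push_cast
        ring
      rw [this, hrK]
    have hyint : IsIntegral ℤ y := ⟨g, hm, by rwa [aeval_def] at hgy⟩
    have hmp : minpoly ℤ y = g := by
      have hdvd := minpoly.isIntegrallyClosed_dvd hyint hgy
      exact eq_of_monic_of_associated (minpoly.monic hyint) hm
        ((minpoly.irreducible hyint).associated_of_dvd hgi hdvd)
    have hadj : Algebra.adjoin ℤ ({y} : Set K) = Algebra.adjoin ℤ ({t} : Set K) := by
      apply le_antisymm
      · apply Algebra.adjoin_le
        rw [Set.singleton_subset_iff]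
        exact add_mem (Algebra.self_mem_adjoin_singleton ℤ t) (intCast_mem _ b)
      · apply Algebra.adjoin_le
        rw [Set.singleton_subset_iff]
        have : t = y - b := by rw [hy]; ring
        rw [this]
        exact sub_mem (Algebra.self_mem_adjoin_singleton ℤ y) (intCast_mem _ b)
    have hgeny : Algebra.adjoin ℚ ({y} : Set K) = ⊤ := by
      rw [eq_top_iff, ← hgen]
      apply Algebra.adjoin_le
      rw [Set.singleton_subset_iff]
      have : t = y - b := by rw [hy]; ring
      rw [this]
      exact sub_mem (Algebra.self_mem_adjoin_singleton ℚ y) (intCast_mem _ b)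
    let B : PowerBasis ℚ K := PowerBasis.ofAdjoinEqTop (hyint.tower_top) hgeny
    have hB : B.gen = y := PowerBasis.ofAdjoinEqTop_gen _ _
    apply hα
    rw [aux_mem, ← hadj, ← hB]
    apply mem_adjoin_of_smul_prime_smul_of_minpoly_isEisensteinAt (R := ℤ) (B := B) h5
    · rw [hB]; exact hyint
    · exact NumberField.RingOfIntegers.isIntegral_coe α
    · rw [hB, hadj]
      rw [aux_mem] at h5α
      simpa [map_ofNat] using h5α
    · rw [hB, hmp]; exact hE
  · rintro ⟨m, hm⟩
    obtain ⟨a', ha'⟩ := ha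
    set H : ℤ[X] := X ^ 4 + C (-b) * X ^ 3 + C (b ^ 2) * X ^ 2 + C (-b ^ 3) * X +
      C (b ^ 4 + a) with hH
    have hHt : aeval t H = t ^ 4 - b * t ^ 3 + b ^ 2 * t ^ 2 - b ^ 3 * t + (b ^ 4 + a) := by
      rw [hH]
      simp
      ring
    have h50 : (5 : K) ≠ 0 := by norm_num
    set α : K := aeval t H / 5 with hα
    have h5α : 5 * α = aeval t H := by rw [hα]; field_simp
    have hmK : (b : K) ^ 5 + a * b - b = 25 * m := by exact_mod_cast congrArg (Int.cast : ℤ → K) hm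
    have haK : (a : K) = 5 * a' := by exact_mod_cast congrArg (Int.cast : ℤ → K) ha'
    have hαy : α * (t + b) = 5 * m := by
      have : 5 * (α * (t + b)) = 5 * (5 * m) := by
        rw [← mul_assoc, h5α, hHt]
        linear_combination hrK + hmK
      exact mul_left_cancel₀ h50 this
    let y : NumberField.RingOfIntegers K := θ + b
    let p : NumberField.RingOfIntegers K :=
      -b * y ^ 3 + 2 * b ^ 2 * y ^ 2 - 2 * b ^ 3 * y + b ^ 4 + a'
    have hyK : (y : K) = t + b := by simp [y, ht]
    have hpK : (p : K) =
        -b * (t + b) ^ 3 + 2 * b ^ 2 * (t + b) ^ 2 - 2 * b ^ 3 * (t + b) + b ^ 4 + a' := by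
      simp [p, y, ht, map_ofNat]
    have hαp : 5 * α = (y : K) ^ 4 + 5 * (p : K) := by
      rw [h5α, hHt, hpK, hyK, haK]
      ring
    have hquad : α ^ 2 - (p : K) * α - m * (y : K) ^ 3 = 0 := by
      have : 5 * (α ^ 2 - (p : K) * α - m * (y : K) ^ 3) = 5 * 0 := by
        rw [← hyK] at hαy
        linear_combination α * hαp + (y : K) ^ 3 * hαy
      exact mul_left_cancel₀ h50 this
    have hint : IsIntegral (NumberField.RingOfIntegers K) α := by
      refine ⟨X ^ 2 - C p * X - C (m * y ^ 3), by monicity!, ?_⟩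
      simp only [eval₂_sub, eval₂_mul, eval₂_pow, eval₂_X, eval₂_C]
      simp only [map_mul, map_pow, map_intCast]
      exact hquad
    obtain ⟨β, hβ⟩ := IsIntegrallyClosed.isIntegral_iff.1 hint
    have hfm : f.Monic := by rw [hf]; monicity!
    have hfd : f.natDegree = 5 := by rw [hf]; compute_degree!
    have hft : aeval t f = 0 := by rw [hf]; simpa using hrK
    have htint : IsIntegral ℤ t := NumberField.RingOfIntegers.isIntegral_coe θ
    have hfi : Irreducible f :=
      (hfm.irreducible_iff_irreducible_map_fraction_map (K := ℚ)).2 hirr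
    have hmp : minpoly ℤ t = f :=
      eq_of_monic_of_associated (minpoly.monic htint) hfm
        ((minpoly.irreducible htint).associated_of_dvd hfi
          (minpoly.isIntegrallyClosed_dvd htint hft))
    refine ⟨β, ?_, ?_⟩
    · rw [aux_mem]
      change algebraMap _ K β ∉ _
      rw [hβ, Algebra.adjoin_singleton_eq_range_aeval]
      rintro ⟨q, hq⟩
      have hq' : aeval t q = α := hq
      have h0 : aeval t (H - C 5 * q) = 0 := by
        rw [map_sub, map_mul, hq', ← h5α, aeval_C]
        simp
      have hdvd := minpoly.isIntegrallyClosed_dvd htint h0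
      rw [hmp] at hdvd
      have hdvd5 := Polynomial.map_dvd (Int.castRingHom (ZMod 5)) hdvd
      have : Fact (Nat.Prime 5) := ⟨by norm_num⟩
      have h55 : (Int.castRingHom (ZMod 5)) 5 = 0 := by
        rw [eq_intCast, ZMod.intCast_zmod_eq_zero_iff_dvd]
        norm_num
      rw [Polynomial.map_sub, Polynomial.map_mul, Polynomial.map_C, h55, C_0, zero_mul,
        sub_zero] at hdvd5
      have hHm : H.Monic := by rw [hH]; monicity!
      have hHd : H.natDegree = 4 := by rw [hH]; compute_degree!
      have hle := natDegree_le_of_dvd hdvd5 (hHm.map _).ne_zero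
      rw [hHm.natDegree_map, hfm.natDegree_map] at hle
      omega
    · rw [aux_mem]
      have : ((5 * β : NumberField.RingOfIntegers K) : K) = aeval t H := by
        rw [← h5α, ← hβ]
        simp [map_ofNat]
      rw [this]
      exact aeval_mem_adjoin_singleton ℤ t
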